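/- Let P be a positive random field on X^{ℤ^d} and F a filtration. Let t ≠ s be points of ℤ^d and let x̄ ∈ 𝒳_{{t,s}}(F) be such that g_{{t,s}}^{x̄}(w) > 0 for all w ∈ X^{{t,s}}. Then for all x, u ∈ X^{{t}} and y, v ∈ X^{{s}} the one-point transition energies are defined and satisfy the consistency condition Δ_t^{x̄y}(x,u) + Δ_s^{x̄u}(y,v) = Δ_s^{x̄x}(y,v) + Δ_t^{x̄v}(x,u). -/

import Mathlib

open MeasureTheory Filter Topology

noncomputable section

/-- Sites of the lattice `ℤ^d`. -/
abbrev Site (d : ℕ) := Fin d → ℤ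

/-- Configurations on the whole lattice. -/
abbrev Config (d : ℕ) (X : Type*) := Site d → X

variable {d : ℕ} {X : Type*}

/-- The configuration equal to `x` on `V` and to `z` off `V` (the concatenation `xz`). -/
def concat (V : Finset (Site d)) (x z : Config d X) : Config d X :=
  fun t => if t ∈ V then x t else z t

/-- The configuration equal to `u` on `I` and to `y` off `I`. -/
def extCfg (I : Finset (Site d)) (u : {s // s ∈ I} → X) (y : Config d X) : Config d X :=
  fun t => if h : t ∈ I then u ⟨t, h⟩ else y t

/-- The cylinder set determined by the values of `z` on `Λ`. -/
def cyl (Λ : Finset (Site d)) (z : Config d X) : Set (Config d X) :=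
  {ω | ∀ t ∈ Λ, ω t = z t}

/-- Finite-dimensional distribution `P_Λ(z)`. -/
def fdd [MeasurableSpace X] (P : Measure (Config d X)) (Λ : Finset (Site d))
    (z : Config d X) : ℝ :=
  (P (cyl Λ z)).toReal

/-- A positive random field: all finite-dimensional distributions are positive. -/
def IsPositiveRF [MeasurableSpace X] (P : Measure (Config d X)) : Prop :=
  ∀ Λ : Finset (Site d), Λ.Nonempty → ∀ z : Config d X, 0 < fdd P Λ z

/-- Finite-conditional probability `g_V^z(x)` with boundary condition `z` on `Λ`. -/
def gfin [MeasurableSpace X] (P : Measure (Config d X)) (V Λ : Finset (Site d))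
    (x z : Config d X) : ℝ :=
  fdd P (V ∪ Λ) (concat V x z) / fdd P Λ z

/-- A filtration: an increasing sequence of finite subsets of the lattice with union `ℤ^d`. -/
structure Filt (d : ℕ) where
  Λ : ℕ → Finset (Site d)
  mono : Monotone Λ
  covers : ∀ t : Site d, ∃ n, t ∈ Λ n

/-- The set `𝒳_V(F)` of admissible boundary conditions: those `x̄` for which all the limits
`lim_n g_V^{x̄_{Λ_n ∖ V}}(x)` exist. (Only the values of `x̄` off `V` are ever used.) -/
def admissible [MeasurableSpace X] (P : Measure (Config d X)) (V : Finset (Site d))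
    (F : Filt d) : Set (Config d X) :=
  {xb | ∀ x : Config d X, ∃ L : ℝ,
    Tendsto (fun n => gfin P V (F.Λ n \ V) x xb) atTop (𝓝 L)}

/-- The conditional probability `g_V^{x̄}(x)` : the limit of `g_V^{x̄_{Λ_n ∖ V}}(x)`. -/
def gCond [MeasurableSpace X] (P : Measure (Config d X)) (V : Finset (Site d))
    (F : Filt d) (xb x : Config d X) : ℝ :=
  limUnder atTop (fun n => gfin P V (F.Λ n \ V) x xb)

/-- Transition energy `Δ_V^{x̄}(x,u) = ln (g_V^{x̄}(x) / g_V^{x̄}(u))`. -/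
def TE [MeasurableSpace X] (P : Measure (Config d X)) (V : Finset (Site d))
    (F : Filt d) (xb x u : Config d X) : ℝ :=
  Real.log (gCond P V F xb x / gCond P V F xb u)

/-- Quasilocality (on boundary conditions off `V`) of a function `h` on a set `Y` of
boundary conditions. -/
def QuasilocalOn (V : Finset (Site d)) (Y : Set (Config d X)) (h : Config d X → ℝ) : Prop :=
  ∀ ε > 0, ∃ Λε : Finset (Site d), Disjoint Λε V ∧
    ∀ Λ : Finset (Site d), Disjoint Λ V → Λε ⊆ Λ →
      ∀ xb ∈ Y, ∀ yb ∈ Y, (∀ s ∈ Λ, xb s = yb s) → |h xb - h yb| < ε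

/-- `Y` represents a set of boundary conditions on `ℤ^d ∖ {t}`: membership does not depend
on the value at `t`. -/
def IsBCSet (t : Site d) (Y : Set (Config d X)) : Prop :=
  ∀ (ω : Config d X) (a : X), ω ∈ Y → Function.update ω t a ∈ Y

/-- `F` is a determining filtration for `P` with sets `Y t` of admissible boundary conditions:
the one-point finite-conditional probabilities converge, uniformly over `Y t`, to positive
limits, and `P(Y t) = 1`. -/
structure IsDetermining [MeasurableSpace X] (P : Measure (Config d X)) (F : Filt d)
    (Y : Site d → Set (Config d X)) : Prop where
  meas : ∀ t, MeasurableSet (Y t)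
  bc : ∀ t, IsBCSet t (Y t)
  adm : ∀ t, Y t ⊆ admissible P {t} F
  full : ∀ t, P (Y t) = 1
  pos : ∀ t, ∀ xb ∈ Y t, ∀ x : X, 0 < gCond P {t} F xb (fun _ => x)
  unif : ∀ (t : Site d) (x : X), ∀ ε > 0, ∃ N, ∀ n ≥ N, ∀ xb ∈ Y t,
    |gfin P {t} (F.Λ n \ {t}) (fun _ => x) xb - gCond P {t} F xb (fun _ => x)| < ε

/-- The probabilistic (Pr--) definition of a Gibbs random field. -/
def IsGibbsRF [MeasurableSpace X] (P : Measure (Config d X)) : Prop :=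
  IsProbabilityMeasure P ∧ IsPositiveRF P ∧
    ∃ (F : Filt d) (Y : Site d → Set (Config d X)), IsDetermining P F Y

theorem fdd_congr [MeasurableSpace X] (P : Measure (Config d X)) {Λ : Finset (Site d)}
    {z z' : Config d X} (h : ∀ r ∈ Λ, z r = z' r) : fdd P Λ z = fdd P Λ z' := by
  have : cyl Λ z = cyl Λ z' := by
    ext ω
    exact forall₂_congr fun r hr => by rw [h r hr]
  rw [fdd, fdd, this]

theorem measurableSet_cyl [MeasurableSpace X] [MeasurableSingletonClass X]
    (Λ : Finset (Site d)) (z : Config d X) : MeasurableSet (cyl Λ z) := by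
  have : cyl Λ z = ⋂ r ∈ Λ, (fun ω : Config d X => ω r) ⁻¹' {z r} := by
    ext ω
    simp [cyl]
  rw [this]
  exact Finset.measurableSet_biInter _ fun r _ =>
    measurable_pi_apply r (measurableSet_singleton _)

/-- Finite-dimensional distributions are consistent under adding one site. -/
theorem sum_fdd_insert [Fintype X] [MeasurableSpace X] [MeasurableSingletonClass X]
    (P : Measure (Config d X)) [IsFiniteMeasure P] {Λ : Finset (Site d)} {t : Site d}
    (ht : t ∉ Λ) (z : Config d X) :
    ∑ a, fdd P (insert t Λ) (Function.update z t a) = fdd P Λ z := by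
  have hne : ∀ r ∈ Λ, r ≠ t := fun r hr h => ht (h ▸ hr)
  have hU : cyl Λ z = ⋃ a, cyl (insert t Λ) (Function.update z t a) := by
    ext ω
    simp only [cyl, Set.mem_ofPred_eq, Set.mem_iUnion, Finset.forall_mem_insert,
      Function.update_self]
    constructor
    · intro h
      exact ⟨ω t, rfl, fun r hr => by rw [Function.update_of_ne (hne r hr), h r hr]⟩
    · rintro ⟨a, -, h⟩ r hr
      rw [h r hr, Function.update_of_ne (hne r hr)]
  have hd : Pairwise (Function.onFun Disjoint
      fun a => cyl (insert t Λ) (Function.update z t a)) := by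
    intro a b hab
    refine Set.disjoint_left.2 fun ω ha hb => hab ?_
    have h₁ := ha t (Finset.mem_insert_self _ _)
    have h₂ := hb t (Finset.mem_insert_self _ _)
    rw [Function.update_self] at h₁ h₂
    exact h₁.symm.trans h₂
  simp only [fdd]
  rw [hU, measure_iUnion hd fun a => measurableSet_cyl _ _, tsum_fintype,
    ENNReal.toReal_sum fun a _ => measure_ne_top _ _]

theorem IsPositiveRF.fdd_pos [MeasurableSpace X] {P : Measure (Config d X)}
    [IsProbabilityMeasure P] (hP : IsPositiveRF P) (Λ : Finset (Site d)) (z : Config d X) :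
    0 < fdd P Λ z := by
  rcases Λ.eq_empty_or_nonempty with rfl | h
  · simp [fdd, cyl]
  · exact hP Λ h z

/-- One-point finite-conditional probabilities in terms of two-point ones. -/
theorem gfin_singleton_eq_div [Fintype X] [MeasurableSpace X] [MeasurableSingletonClass X]
    {P : Measure (Config d X)} [IsProbabilityMeasure P] (hP : IsPositiveRF P)
    {Λ : Finset (Site d)} {t s : Site d} (hts : t ≠ s) (hs : s ∈ Λ)
    (xb w : Config d X) (y : X) :
    gfin P {t} (Λ \ {t}) w (Function.update xb s y) =
      gfin P {t, s} (Λ \ {t, s}) (Function.update (Function.update xb t (w t)) s y) xb /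
        ∑ a, gfin P {t, s} (Λ \ {t, s}) (Function.update (Function.update xb t a) s y) xb := by
  have hset : ({t, s} : Finset (Site d)) ∪ Λ \ {t, s} = insert t (Λ \ {t}) := by
    grind
  have hnum (a : X) : fdd P ({t, s} ∪ Λ \ {t, s})
      (concat {t, s} (Function.update (Function.update xb t a) s y) xb) =
      fdd P (insert t (Λ \ {t})) (Function.update (Function.update xb s y) t a) := by
    rw [hset]
    refine fdd_congr P fun r _ => ?_
    rw [Function.update_comm hts]
    simp only [concat, Function.update_apply]
    grind
  have hone : fdd P ({t} ∪ Λ \ {t}) (concat {t} w (Function.update xb s y)) =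
      fdd P (insert t (Λ \ {t})) (Function.update (Function.update xb s y) t (w t)) := by
    rw [← Finset.insert_eq]
    refine fdd_congr P fun r _ => ?_
    simp only [concat, Function.update_apply]
    grind
  simp only [gfin, hnum, hone]
  rw [← Finset.sum_div, sum_fdd_insert P (by simp),
    div_div_div_cancel_right₀ (hP.fdd_pos _ _).ne']

theorem tendsto_gfin_gCond [MeasurableSpace X] {P : Measure (Config d X)}
    {V : Finset (Site d)} {F : Filt d} {xb : Config d X} (hxb : xb ∈ admissible P V F)
    (x : Config d X) :
    Tendsto (fun n => gfin P V (F.Λ n \ V) x xb) atTop (𝓝 (gCond P V F xb x)) :=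
  tendsto_nhds_limUnder (hxb x)

theorem tendsto_gfin_singleton [Fintype X] [Nontrivial X] [MeasurableSpace X]
    [MeasurableSingletonClass X]
    {P : Measure (Config d X)} [IsProbabilityMeasure P] (hP : IsPositiveRF P)
    {F : Filt d} {t s : Site d} (hts : t ≠ s) {xb : Config d X}
    (hxb : xb ∈ admissible P {t, s} F) (hpos : ∀ w : Config d X, 0 < gCond P {t, s} F xb w)
    (w : Config d X) (y : X) :
    Tendsto (fun n => gfin P {t} (F.Λ n \ {t}) w (Function.update xb s y)) atTop
      (𝓝 (gCond P {t, s} F xb (Function.update (Function.update xb t (w t)) s y) /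
        ∑ a, gCond P {t, s} F xb (Function.update (Function.update xb t a) s y))) := by
  have hlim := (tendsto_gfin_gCond hxb (Function.update (Function.update xb t (w t)) s y)).div
    (tendsto_finsetSum Finset.univ fun a _ =>
      tendsto_gfin_gCond hxb (Function.update (Function.update xb t a) s y))
    (Finset.sum_pos (fun a _ => hpos _) Finset.univ_nonempty).ne'
  refine hlim.congr' ?_
  obtain ⟨N, hN⟩ := F.covers s
  filter_upwards [eventually_ge_atTop N] with n hn
  exact (gfin_singleton_eq_div hP hts (F.mono hn hN) xb w y).symm

/-- Admissibility, positivity and transition energies of the one-point conditional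
probabilities induced by a two-point one. -/
theorem singleton_of_pair [Fintype X] [Nontrivial X] [MeasurableSpace X]
    [MeasurableSingletonClass X]
    {P : Measure (Config d X)} [IsProbabilityMeasure P] (hP : IsPositiveRF P)
    {F : Filt d} {t s : Site d} (hts : t ≠ s) {xb : Config d X}
    (hxb : xb ∈ admissible P {t, s} F) (hpos : ∀ w : Config d X, 0 < gCond P {t, s} F xb w)
    (y : X) :
    Function.update xb s y ∈ admissible P {t} F ∧
      (∀ w : Config d X, 0 < gCond P {t} F (Function.update xb s y) w) ∧
      ∀ x u : X, TE P {t} F (Function.update xb s y) (fun _ => x) (fun _ => u) =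
        Real.log (gCond P {t, s} F xb (Function.update (Function.update xb t x) s y)) -
          Real.log (gCond P {t, s} F xb (Function.update (Function.update xb t u) s y)) := by
  have hlim := fun w => tendsto_gfin_singleton hP hts hxb hpos w y
  have hZ : 0 < ∑ a, gCond P {t, s} F xb (Function.update (Function.update xb t a) s y) :=
    Finset.sum_pos (fun a _ => hpos _) Finset.univ_nonempty
  have hg (w : Config d X) : gCond P {t} F (Function.update xb s y) w = _ :=
    (hlim w).limUnder_eq
  refine ⟨fun w => ⟨_, hlim w⟩, fun w => ?_, fun x u => ?_⟩
  · rw [hg]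
    exact div_pos (hpos _) hZ
  · rw [TE, hg, hg, div_div_div_cancel_right₀ hZ.ne',
      Real.log_div (hpos _).ne' (hpos _).ne']

/-- consistency of one-point transition energies, relation (9) / `Delta1P-2`. -/
theorem stmt5 [Fintype X] [Nontrivial X] [MeasurableSpace X] [MeasurableSingletonClass X]
    (P : Measure (Config d X)) [IsProbabilityMeasure P] (hP : IsPositiveRF P)
    (F : Filt d) (t s : Site d) (hts : t ≠ s)
    (xb : Config d X) (hxb : xb ∈ admissible P {t, s} F)
    (hpos : ∀ w : Config d X, 0 < gCond P {t, s} F xb w) :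
    ∀ x u y v : X,
      Function.update xb s y ∈ admissible P {t} F ∧
      Function.update xb s v ∈ admissible P {t} F ∧
      Function.update xb t x ∈ admissible P {s} F ∧
      Function.update xb t u ∈ admissible P {s} F ∧
      (∀ w : Config d X, 0 < gCond P {t} F (Function.update xb s y) w) ∧
      (∀ w : Config d X, 0 < gCond P {t} F (Function.update xb s v) w) ∧
      (∀ w : Config d X, 0 < gCond P {s} F (Function.update xb t x) w) ∧
      (∀ w : Config d X, 0 < gCond P {s} F (Function.update xb t u) w) ∧
      TE P {t} F (Function.update xb s y) (fun _ => x) (fun _ => u) +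
          TE P {s} F (Function.update xb t u) (fun _ => y) (fun _ => v) =
        TE P {s} F (Function.update xb t x) (fun _ => y) (fun _ => v) +
          TE P {t} F (Function.update xb s v) (fun _ => x) (fun _ => u) := by
  intro x u y v
  have ht := singleton_of_pair hP hts hxb hpos
  rw [Finset.pair_comm] at hxb hpos
  have hs := singleton_of_pair hP hts.symm hxb hpos
  refine ⟨(ht y).1, (ht v).1, (hs x).1, (hs u).1, (ht y).2.1, (ht v).2.1, (hs x).2.1,
    (hs u).2.1, ?_⟩
  rw [(ht y).2.2, (ht v).2.2, (hs x).2.2, (hs u).2.2, Finset.pair_comm s t]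
  simp only [Function.update_comm hts]
  ring
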